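/- arXiv:1307.4424 — 2 statements merged into one kernel-verified Lean document; each statement's English description precedes it below -/
import Mathlib

section
/- Let z₁, …, zₙ be distinct points of the upper half-plane and let σ₁, …, σₙ, σ₁*, …, σₙ* be real numbers. Define F(ζ) = -i Σⱼ ( σⱼ/(ζ - zⱼ) + σⱼ*/(ζ - conj(zⱼ)) ). Then for each index j, the function ζ ↦ -(1/2) F(ζ)² - σⱼ²/(2(ζ - zⱼ)²) - cⱼ/(ζ - zⱼ), where cⱼ = σⱼσⱼ*/(zⱼ - conj(zⱼ)) + Σ_{k ≠ j} ( σⱼσ_k/(zⱼ - z_k) + σⱼσ_k*/(zⱼ - conj(z_k)) ), has a finite limit as ζ → zⱼ. -/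
open Finset Filter

/-- If `g` is differentiable at `a`, then the singular part at `a` of half the square of
`s / (ζ - a) + g ζ` is `s ^ 2 / (2 * (ζ - a) ^ 2) + s * g a / (ζ - a)`. -/
theorem tendsto_half_sq_sub_singular {g : ℂ → ℂ} {a g' : ℂ} (hg : HasDerivAt g g' a) (s : ℂ) :
    Tendsto (fun ζ : ℂ => 1 / 2 * (s / (ζ - a) + g ζ) ^ 2 - s ^ 2 / (2 * (ζ - a) ^ 2)
        - s * g a / (ζ - a))
      (nhdsWithin a {a}ᶜ) (nhds (1 / 2 * g a ^ 2 + s * g')) := by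
  have hcont : Tendsto g (nhdsWithin a {a}ᶜ) (nhds (g a)) :=
    hg.continuousAt.tendsto.mono_left nhdsWithin_le_nhds
  refine (((hcont.pow 2).const_mul (1 / 2)).add (hg.tendsto_slope.const_mul s)).congr' ?_
  filter_upwards [self_mem_nhdsWithin] with ζ hζ
  have hne : ζ - a ≠ 0 := sub_ne_zero.mpr hζ
  rw [slope_def_field]
  field_simp
  ring

/-- With `F(ζ) = -i Σⱼ(σⱼ/(ζ - zⱼ) + σⱼ*/(ζ - conj zⱼ))`, the function
`-(1/2)F(ζ)² - σⱼ²/(2(ζ - zⱼ)²) - cⱼ/(ζ - zⱼ)` has a finite limit as `ζ → zⱼ`,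
where `cⱼ = σⱼσⱼ*/(zⱼ - conj zⱼ) + Σ_{k≠j}(σⱼσₖ/(zⱼ - zₖ) + σⱼσₖ*/(zⱼ - conj zₖ))`. -/
theorem stmt10 (n : ℕ) (z : Fin n → ℂ) (hz : ∀ j, 0 < (z j).im)
    (hinj : Function.Injective z) (σ σs : Fin n → ℝ) (j : Fin n) :
    ∃ L : ℂ, Filter.Tendsto
      (fun ζ : ℂ =>
        -(1 / 2) *
            ((-Complex.I) * ∑ k, ((σ k : ℂ) / (ζ - z k)
              + (σs k : ℂ) / (ζ - (starRingEnd ℂ) (z k)))) ^ 2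
          - (σ j : ℂ) ^ 2 / (2 * (ζ - z j) ^ 2)
          - ((σ j : ℂ) * (σs j : ℂ) / (z j - (starRingEnd ℂ) (z j))
              + ∑ k ∈ Finset.univ.erase j,
                  ((σ j : ℂ) * (σ k : ℂ) / (z j - z k)
                    + (σ j : ℂ) * (σs k : ℂ) / (z j - (starRingEnd ℂ) (z k))))
            / (ζ - z j))
      (nhdsWithin (z j) {z j}ᶜ) (nhds L) := by
  have hconj : ∀ k, z j - (starRingEnd ℂ) (z k) ≠ 0 := fun k h => by
    have him := congrArg Complex.im h
    simp only [Complex.sub_im, Complex.conj_im, Complex.zero_im] at him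
    linarith [hz j, hz k]
  have hsub : ∀ k ∈ Finset.univ.erase j, z j - z k ≠ 0 := fun k hk =>
    sub_ne_zero.mpr (hinj.ne (Finset.ne_of_mem_erase hk).symm)
  let g : ℂ → ℂ := fun ζ => (σs j : ℂ) / (ζ - (starRingEnd ℂ) (z j))
    + ∑ k ∈ Finset.univ.erase j,
        ((σ k : ℂ) / (ζ - z k) + (σs k : ℂ) / (ζ - (starRingEnd ℂ) (z k)))
  have hpole : ∀ s w : ℂ, z j - w ≠ 0 → DifferentiableAt ℂ (fun ζ => s / (ζ - w)) (z j) :=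
    fun s w hw => (differentiableAt_const s).div (differentiableAt_id.sub_const w) hw
  have hg : DifferentiableAt ℂ g (z j) :=
    (hpole _ _ (hconj j)).add <| DifferentiableAt.fun_sum fun k hk =>
      (hpole _ _ (hsub k hk)).add (hpole _ _ (hconj k))
  refine ⟨_, (tendsto_half_sq_sub_singular hg.hasDerivAt (σ j : ℂ)).congr fun ζ => ?_⟩
  have hres : (σ j : ℂ) * (σs j : ℂ) / (z j - (starRingEnd ℂ) (z j))
      + ∑ k ∈ Finset.univ.erase j,
          ((σ j : ℂ) * (σ k : ℂ) / (z j - z k)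
            + (σ j : ℂ) * (σs k : ℂ) / (z j - (starRingEnd ℂ) (z k))) = σ j * g (z j) := by
    simp only [g, mul_add, Finset.mul_sum, mul_div_assoc]
  have hsum : ∑ k, ((σ k : ℂ) / (ζ - z k) + (σs k : ℂ) / (ζ - (starRingEnd ℂ) (z k)))
      = σ j / (ζ - z j) + g ζ := by
    rw [← Finset.add_sum_erase _ _ (Finset.mem_univ j), add_assoc]
  rw [hres, hsum, mul_pow, neg_sq, Complex.I_sq]
  ring
end

section
/- Let 0 < ε < π/√2 and set t = log(1 + tan²(ε/√2)). Then there exists a holomorphic bijection φ from S \ {iy : 0 < y ≤ ε√2} onto S, where S = {z ∈ ℂ : 0 < Im z < π}, such that cosh(φ(z)/2) = e^{t/2} cosh(z/2) for all z in the domain, and φ(z) - z → t as Re z → +∞ and φ(z) - z → -t as Re z → -∞. Consequently the strip capacity of the vertical slit [0, iε√2] equals log(1 + tan²(ε/√2)). -/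
open Filter Complex

/-- The holomorphic inverse of `cosh`, from the right half-plane slit along `[1, ∞)`
onto the strip `0 < Im < π / 2`. -/
noncomputable def coshInv (w : ℂ) : ℂ :=
  Complex.log (w + I * Complex.exp (Complex.log (1 - w ^ 2) / 2))

/-- The right half-plane slit along `[1, ∞)`. -/
def slitHalfPlane : Set ℂ := {w | 0 < w.re ∧ (w.im = 0 → w.re < 1)}

lemma one_sub_sq_mem_slitPlane {w : ℂ} (hw : w ∈ slitHalfPlane) :
    1 - w ^ 2 ∈ Complex.slitPlane := by
  obtain ⟨h1, h2⟩ := hw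
  rw [Complex.mem_slitPlane_iff]
  by_cases h : w.im = 0
  · left
    have := h2 h
    simp [pow_two, h]
    nlinarith
  · right
    simp only [pow_two, Complex.sub_im, Complex.one_im, Complex.mul_im]
    intro h'
    have : w.re * w.im = 0 := by linarith
    rcases mul_eq_zero.1 this with h3 | h3
    · exact h1.ne' h3
    · exact h h3

lemma exp_log_half_sq {v : ℂ} (hv : v ≠ 0) :
    Complex.exp (Complex.log v / 2) ^ 2 = v := by
  rw [← Complex.exp_nat_mul]
  push_cast
  rw [mul_div_cancel₀ _ two_ne_zero, Complex.exp_log hv]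

lemma exp_log_half_re_pos {v : ℂ} (hv : v ∈ Complex.slitPlane) :
    0 < (Complex.exp (Complex.log v / 2)).re := by
  rw [Complex.exp_re]
  refine mul_pos (Real.exp_pos _) (Real.cos_pos_of_mem_Ioo ?_)
  have h1 := Complex.neg_pi_lt_arg v
  have h2 := Complex.arg_le_pi v
  have h3 := Complex.mem_slitPlane_iff_arg.1 hv
  have h4 : v.arg < Real.pi := lt_of_le_of_ne h2 h3.1
  have h5 : (Complex.log v / 2).im = v.arg / 2 := by
    rw [show (2 : ℂ) = ((2 : ℝ) : ℂ) by norm_num, Complex.div_ofReal_im, Complex.log_im]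
  rw [h5]
  constructor <;> linarith

/-- A point `u = w + i s` with `w² + s² = 1` and `Re w, Re s > 0` lies in the first quadrant. -/
lemma re_pos_im_pos_of_sq_add_sq_eq_one {w s : ℂ} (h : w ^ 2 + s ^ 2 = 1)
    (hw : 0 < w.re) (hs : 0 < s.re) :
    0 < (w + I * s).re ∧ 0 < (w + I * s).im := by
  have hre : w.re ^ 2 - w.im ^ 2 + s.re ^ 2 - s.im ^ 2 = 1 := by
    have := congrArg Complex.re h
    simp [pow_two] at this
    linarith
  have him : w.re * w.im + s.re * s.im = 0 := by
    have := congrArg Complex.im h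
    simp [pow_two] at this
    linarith
  simp only [Complex.add_re, Complex.add_im, Complex.mul_re, Complex.mul_im, Complex.I_re,
    Complex.I_im]
  constructor <;> by_contra! hc
  · have h1 : w.re ≤ s.im := by linarith
    have h2 : -w.im < s.re := lt_of_pow_lt_pow_left₀ 2 hs.le (by nlinarith)
    nlinarith [mul_lt_mul_of_pos_left h2 hw, mul_le_mul_of_nonneg_left h1 hs.le]
  · have h1 : s.re ≤ -w.im := by linarith
    have h2 : s.im < w.re := lt_of_pow_lt_pow_left₀ 2 hw.le (by nlinarith)
    nlinarith [mul_lt_mul_of_pos_left h2 hs, mul_le_mul_of_nonneg_left h1 hw.le]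

lemma add_I_mul_mem_quadrant {w : ℂ} (hw : w ∈ slitHalfPlane) :
    0 < (w + I * Complex.exp (Complex.log (1 - w ^ 2) / 2)).re ∧
      0 < (w + I * Complex.exp (Complex.log (1 - w ^ 2) / 2)).im := by
  have hm := one_sub_sq_mem_slitPlane hw
  refine re_pos_im_pos_of_sq_add_sq_eq_one ?_ hw.1 (exp_log_half_re_pos hm)
  rw [exp_log_half_sq (Complex.slitPlane_ne_zero hm)]
  ring

lemma coshInv_im_mem {w : ℂ} (hw : w ∈ slitHalfPlane) :
    0 < (coshInv w).im ∧ (coshInv w).im < Real.pi / 2 := by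
  obtain ⟨h1, h2⟩ := add_I_mul_mem_quadrant hw
  rw [coshInv, Complex.log_im]
  refine ⟨?_, Complex.arg_lt_pi_div_two_iff.2 (Or.inl h1)⟩
  refine lt_of_le_of_ne (Complex.arg_nonneg_iff.2 h2.le) fun h => ?_
  exact h2.ne' (Complex.arg_eq_zero_iff.1 h.symm).2

lemma cosh_coshInv {w : ℂ} (hw : w ∈ slitHalfPlane) : Complex.cosh (coshInv w) = w := by
  have hm := one_sub_sq_mem_slitPlane hw
  have hs := exp_log_half_sq (Complex.slitPlane_ne_zero hm)
  have hq := (add_I_mul_mem_quadrant hw).1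
  rw [Complex.cosh, Complex.exp_neg, coshInv]
  set s := Complex.exp (Complex.log (1 - w ^ 2) / 2)
  have h0 : w + I * s ≠ 0 := fun h => by simp [h] at hq
  have hinv : (w + I * s)⁻¹ = w - I * s := by
    refine inv_eq_of_mul_eq_one_right ?_
    linear_combination hs - s ^ 2 * Complex.I_sq
  rw [Complex.exp_log h0, hinv]
  ring

lemma differentiableAt_coshInv {w : ℂ} (hw : w ∈ slitHalfPlane) :
    DifferentiableAt ℂ coshInv w := by
  have hm := one_sub_sq_mem_slitPlane hw
  have hq : w + I * Complex.exp (Complex.log (1 - w ^ 2) / 2) ∈ Complex.slitPlane :=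
    Or.inl (add_I_mul_mem_quadrant hw).1
  unfold coshInv
  refine DifferentiableAt.clog ?_ hq
  refine differentiableAt_id.add (DifferentiableAt.const_mul ?_ _)
  refine DifferentiableAt.cexp (DifferentiableAt.div_const ?_ _)
  exact DifferentiableAt.clog (by fun_prop) hm

lemma cosh_re_eq (z : ℂ) : (Complex.cosh z).re = Real.cosh z.re * Real.cos z.im := by
  conv_lhs => rw [← Complex.re_add_im z, Complex.cosh_add, Complex.cosh_mul_I, Complex.sinh_mul_I]
  simp [Complex.cos_ofReal_re]

lemma cosh_im_eq (z : ℂ) : (Complex.cosh z).im = Real.sinh z.re * Real.sin z.im := by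
  conv_lhs => rw [← Complex.re_add_im z, Complex.cosh_add, Complex.cosh_mul_I, Complex.sinh_mul_I]
  simp [Complex.sin_ofReal_re, Complex.sinh_ofReal_re]

/-- `c * cosh` maps points of the half-strip, off the slit where `c * cos y ≥ 1`,
into the slit half-plane. -/
lemma mul_cosh_mem_slitHalfPlane {c : ℝ} (hc : 0 < c) {a : ℂ} (h0 : 0 < a.im)
    (h1 : a.im < Real.pi / 2) (h : a.re = 0 → c * Real.cos a.im < 1) :
    (c : ℂ) * Complex.cosh a ∈ slitHalfPlane := by
  have hcos : 0 < Real.cos a.im := Real.cos_pos_of_mem_Ioo ⟨by linarith, h1⟩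
  have hsin : 0 < Real.sin a.im := Real.sin_pos_of_pos_of_lt_pi h0 (by linarith)
  refine ⟨?_, fun him => ?_⟩
  · rw [Complex.re_ofReal_mul, cosh_re_eq]
    exact mul_pos hc (mul_pos (Real.cosh_pos _) hcos)
  · rw [Complex.im_ofReal_mul, cosh_im_eq] at him
    have hre : a.re = 0 := by
      simpa [hc.ne', hsin.ne'] using him
    rw [Complex.re_ofReal_mul, cosh_re_eq, hre, Real.cosh_zero, one_mul]
    exact h hre

lemma cosh_injOn_halfStrip :
    Set.InjOn Complex.cosh {a : ℂ | 0 < a.im ∧ a.im < Real.pi / 2} := by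
  intro a ha b hb hab
  have hpi := Real.pi_pos
  obtain ⟨ha0, ha1⟩ := ha
  obtain ⟨hb0, hb1⟩ := hb
  rw [← Complex.cos_mul_I, ← Complex.cos_mul_I, Complex.cos_eq_cos_iff] at hab
  obtain ⟨k, hk | hk⟩ := hab
  · have hre := congrArg Complex.re hk
    have him := congrArg Complex.im hk
    simp at hre him
    have h2 : (k : ℝ) < 1 := by by_contra! h; nlinarith
    have h3 : (-1 : ℝ) < k := by by_contra! h; nlinarith
    have hk0 : k = 0 := by
      have h2' : k < 1 := by exact_mod_cast h2
      have h3' : -1 < k := by exact_mod_cast h3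
      omega
    subst hk0
    simp at hre
    exact Complex.ext him.symm hre.symm
  · have hre := congrArg Complex.re hk
    simp at hre
    have h2 : (k : ℝ) < 0 := by by_contra! h; nlinarith
    have h3 : (-1 : ℝ) < k := by by_contra! h; nlinarith
    have h2' : k < 0 := by exact_mod_cast h2
    have h3' : -1 < k := by exact_mod_cast h3
    omega

lemma coshInv_cosh {a : ℂ} (h0 : 0 < a.im) (h1 : a.im < Real.pi / 2) :
    coshInv (Complex.cosh a) = a := by
  have hmem : Complex.cosh a ∈ slitHalfPlane := by
    have := mul_cosh_mem_slitHalfPlane one_pos h0 h1 fun _ => by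
      rw [one_mul, ← Real.cos_zero]
      exact Real.cos_lt_cos_of_nonneg_of_le_pi_div_two le_rfl h1.le h0
    simpa using this
  exact cosh_injOn_halfStrip (coshInv_im_mem hmem) ⟨h0, h1⟩ (cosh_coshInv hmem)

/-- If `cosh F = c * cosh A` with `Re F > 0` and `|Im (F - A)| < π`, then `F - A → log c` as
`Re A → ∞`. -/
lemma tendsto_sub_of_cosh_eq_mul_cosh {l : Filter ℂ} {F A : ℂ → ℂ} {c : ℝ} (hc : 0 < c)
    (hcosh : ∀ᶠ z in l, Complex.cosh (F z) = c * Complex.cosh (A z))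
    (hF : ∀ᶠ z in l, 0 < (F z).re)
    (him : ∀ᶠ z in l, |(F z - A z).im| < Real.pi)
    (hA : Tendsto (fun z => (A z).re) l atTop) :
    Tendsto (fun z => F z - A z) l (nhds (Real.log c : ℂ)) := by
  have hz : Tendsto (fun z => Real.exp (-(A z).re)) l (nhds 0) :=
    Real.tendsto_exp_neg_atTop_nhds_zero.comp hA
  have h1 : Tendsto (fun z => Complex.exp (-A z)) l (nhds 0) := by
    rw [tendsto_zero_iff_norm_tendsto_zero]
    simpa [Complex.norm_exp] using hz
  have h2 : Tendsto (fun z => Complex.exp (-F z) * Complex.exp (-A z)) l (nhds 0) := by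
    refine squeeze_zero_norm' ?_ hz
    filter_upwards [hF] with z hFz
    rw [norm_mul, Complex.norm_exp, Complex.norm_exp, Complex.neg_re, Complex.neg_re]
    exact mul_le_of_le_one_left (Real.exp_pos _).le (Real.exp_le_one_iff.2 (by linarith))
  have h3 : Tendsto (fun z => Complex.exp (F z - A z)) l (nhds (c : ℂ)) := by
    have h4 := ((h1.pow 2).const_add 1 |>.const_mul (c : ℂ)).sub h2
    have h5 : (c : ℂ) * (1 + 0 ^ 2) - 0 = c := by ring
    rw [h5] at h4
    refine h4.congr' ?_
    filter_upwards [hcosh] with z hzc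
    have hAA : Complex.exp (A z) * Complex.exp (-A z) = 1 := by
      rw [← Complex.exp_add, add_neg_cancel, Complex.exp_zero]
    rw [Complex.cosh, Complex.cosh] at hzc
    rw [sub_eq_add_neg (F z), Complex.exp_add]
    linear_combination (-2 * Complex.exp (-A z)) * hzc - c * hAA
  have h6 := h3.clog (Complex.ofReal_mem_slitPlane.2 hc)
  rw [← Complex.ofReal_log hc.le] at h6
  refine h6.congr' ?_
  filter_upwards [him] with z hzi
  have := abs_lt.1 hzi
  exact Complex.log_exp this.1 this.2.le

lemma re_pos_iff_of_cosh_eq_mul_cosh {c : ℝ} (hc : 0 < c) {a b : ℂ}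
    (ha0 : 0 < a.im) (ha1 : a.im < Real.pi / 2) (hb0 : 0 < b.im) (hb1 : b.im < Real.pi / 2)
    (h : Complex.cosh b = c * Complex.cosh a) :
    (0 < a.re → 0 < b.re) ∧ (a.re < 0 → b.re < 0) := by
  have hsa : 0 < Real.sin a.im := Real.sin_pos_of_pos_of_lt_pi ha0 (by linarith)
  have hsb : 0 < Real.sin b.im := Real.sin_pos_of_pos_of_lt_pi hb0 (by linarith)
  have him := congrArg Complex.im h
  rw [Complex.im_ofReal_mul, cosh_im_eq, cosh_im_eq] at him
  constructor
  · intro ha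
    have : 0 < Real.sinh b.re * Real.sin b.im := by
      rw [him]
      exact mul_pos hc (mul_pos (Real.sinh_pos_iff.2 ha) hsa)
    exact Real.sinh_pos_iff.1 (pos_of_mul_pos_left this hsb.le)
  · intro ha
    have : Real.sinh b.re * Real.sin b.im < 0 := by
      rw [him]
      exact mul_neg_of_pos_of_neg hc (mul_neg_of_neg_of_pos (Real.sinh_neg_iff.2 ha) hsa)
    exact Real.sinh_neg_iff.1 (neg_of_mul_neg_left this hsb.le)

/-- The vertical slit map of the strip `S = {0 < Im z < π}`: with
`t = log(1 + tan²(ε/√2))`, there is a holomorphic bijection `φ` from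
`S \ [0, iε√2]` onto `S` with `cosh(φ(z)/2) = e^{t/2} cosh(z/2)` and
`φ(z) - z → ±t` as `Re z → ±∞`; hence `scap([0, iε√2]) = log(1 + tan²(ε/√2))`. -/
theorem stmt14 (ε : ℝ) (hε0 : 0 < ε) (hε1 : ε < Real.pi / Real.sqrt 2) :
    ∃ φ : ℂ → ℂ,
      Set.BijOn φ
        ({z : ℂ | 0 < z.im ∧ z.im < Real.pi} \
          {z : ℂ | z.re = 0 ∧ 0 < z.im ∧ z.im ≤ ε * Real.sqrt 2})
        {z : ℂ | 0 < z.im ∧ z.im < Real.pi} ∧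
      DifferentiableOn ℂ φ
        ({z : ℂ | 0 < z.im ∧ z.im < Real.pi} \
          {z : ℂ | z.re = 0 ∧ 0 < z.im ∧ z.im ≤ ε * Real.sqrt 2}) ∧
      (∀ z ∈ ({z : ℂ | 0 < z.im ∧ z.im < Real.pi} \
          {z : ℂ | z.re = 0 ∧ 0 < z.im ∧ z.im ≤ ε * Real.sqrt 2}),
        Complex.cosh (φ z / 2)
          = Complex.exp ((Real.log (1 + Real.tan (ε / Real.sqrt 2) ^ 2) : ℂ) / 2)
              * Complex.cosh (z / 2)) ∧
      Tendsto (fun z : ℂ => φ z - z)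
        (comap Complex.re atTop ⊓
          Filter.principal ({z : ℂ | 0 < z.im ∧ z.im < Real.pi} \
            {z : ℂ | z.re = 0 ∧ 0 < z.im ∧ z.im ≤ ε * Real.sqrt 2}))
        (nhds ((Real.log (1 + Real.tan (ε / Real.sqrt 2) ^ 2) : ℂ))) ∧
      Tendsto (fun z : ℂ => φ z - z)
        (comap Complex.re atBot ⊓
          Filter.principal ({z : ℂ | 0 < z.im ∧ z.im < Real.pi} \
            {z : ℂ | z.re = 0 ∧ 0 < z.im ∧ z.im ≤ ε * Real.sqrt 2}))
        (nhds (-(Real.log (1 + Real.tan (ε / Real.sqrt 2) ^ 2) : ℂ))) := by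
  have h2 : (0 : ℝ) < Real.sqrt 2 := by positivity
  set θ : ℝ := ε / Real.sqrt 2 with hθ
  have hθ0 : 0 < θ := div_pos hε0 h2
  have hεθ : ε * Real.sqrt 2 = 2 * θ := by
    rw [hθ]
    field_simp
    rw [Real.sq_sqrt (by norm_num)]
  have hθ1 : θ < Real.pi / 2 := by
    rw [lt_div_iff₀ h2] at hε1
    linarith
  have hcosθ : 0 < Real.cos θ := Real.cos_pos_of_mem_Ioo ⟨by linarith, hθ1⟩
  have hlog : Real.log (1 + Real.tan θ ^ 2) = 2 * Real.log (Real.cos θ)⁻¹ := by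
    rw [← inv_inv (1 + Real.tan θ ^ 2), Real.inv_one_add_tan_sq hcosθ.ne', ← inv_pow,
      Real.log_pow, Nat.cast_ofNat]
  rw [hεθ, hlog]
  set D : Set ℂ := {z : ℂ | 0 < z.im ∧ z.im < Real.pi} \
    {z : ℂ | z.re = 0 ∧ 0 < z.im ∧ z.im ≤ 2 * θ}
  set c : ℝ := (Real.cos θ)⁻¹ with hc_def
  have hc : 0 < c := inv_pos.2 hcosθ
  have hexp : Complex.exp (((2 * Real.log c : ℝ) : ℂ) / 2) = c := by
    rw [Complex.ofReal_mul, Complex.ofReal_ofNat, mul_div_cancel_left₀ _ two_ne_zero,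
      ← Complex.ofReal_exp, Real.exp_log hc]
  rw [hexp]
  have him2 : ∀ z : ℂ, (z / 2).im = z.im / 2 := fun z => by
    rw [← Complex.ofReal_ofNat, Complex.div_ofReal_im]
  have hre2 : ∀ z : ℂ, (z / 2).re = z.re / 2 := fun z => by
    rw [← Complex.ofReal_ofNat, Complex.div_ofReal_re]
  have hhalf : ∀ z ∈ {z : ℂ | 0 < z.im ∧ z.im < Real.pi},
      0 < (z / 2).im ∧ (z / 2).im < Real.pi / 2 := fun z hz => by
    rw [him2]
    exact ⟨by linarith [hz.1], by linarith [hz.2]⟩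
  have hmem : ∀ z ∈ D, (c : ℂ) * Complex.cosh (z / 2) ∈ slitHalfPlane := by
    rintro z ⟨hz, hzs⟩
    obtain ⟨h0, h1⟩ := hhalf z hz
    refine mul_cosh_mem_slitHalfPlane hc h0 h1 fun hre => ?_
    rw [hre2] at hre
    have hlt : θ < (z / 2).im := by
      by_contra! hle
      rw [him2] at hle
      exact hzs ⟨by linarith, hz.1, by linarith⟩
    rw [hc_def, inv_mul_lt_one₀ hcosθ]
    exact Real.cos_lt_cos_of_nonneg_of_le_pi_div_two hθ0.le h1.le hlt
  have hcosh : ∀ z ∈ D,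
      Complex.cosh (coshInv (c * Complex.cosh (z / 2))) = c * Complex.cosh (z / 2) :=
    fun z hz => cosh_coshInv (hmem z hz)
  have himlt : ∀ z ∈ D, |(coshInv (c * Complex.cosh (z / 2)) - z / 2).im| < Real.pi := by
    intro z hz
    obtain ⟨h0, h1⟩ := coshInv_im_mem (hmem z hz)
    obtain ⟨h3, h4⟩ := hhalf z hz.1
    rw [Complex.sub_im, abs_lt]
    constructor <;> linarith
  have hsign := fun z hz => re_pos_iff_of_cosh_eq_mul_cosh hc (hhalf z hz.1).1 (hhalf z hz.1).2
    (coshInv_im_mem (hmem z hz)).1 (coshInv_im_mem (hmem z hz)).2 (hcosh z hz)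
  refine ⟨fun z => 2 * coshInv (c * Complex.cosh (z / 2)), ⟨?_, ?_, ?_⟩, ?_, ?_, ?_, ?_⟩
  · intro z hz
    obtain ⟨h0, h1⟩ := coshInv_im_mem (hmem z hz)
    simp only [Set.mem_ofPred_eq, Complex.mul_im, Complex.re_ofNat, Complex.im_ofNat, zero_mul,
      add_zero]
    constructor <;> linarith
  · intro z hz z' hz' h
    have h' := mul_left_cancel₀ two_ne_zero h
    have h'' := congrArg Complex.cosh h'
    rw [hcosh z hz, hcosh z' hz'] at h''
    have h3 := cosh_injOn_halfStrip (hhalf z hz.1) (hhalf z' hz'.1)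
      (mul_left_cancel₀ (Complex.ofReal_ne_zero.2 hc.ne') h'')
    exact (div_left_inj' two_ne_zero).1 h3
  · intro v hv
    obtain ⟨h0, h1⟩ := hhalf v hv
    have hcos : 0 < Real.cos (v / 2).im := Real.cos_pos_of_mem_Ioo ⟨by linarith, h1⟩
    have hcos1 : Real.cos (v / 2).im < 1 := by
      rw [← Real.cos_zero]
      exact Real.cos_lt_cos_of_nonneg_of_le_pi_div_two le_rfl h1.le h0
    have hw : ((Real.cos θ : ℝ) : ℂ) * Complex.cosh (v / 2) ∈ slitHalfPlane :=
      mul_cosh_mem_slitHalfPlane hcosθ h0 h1 fun _ =>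
        mul_lt_one_of_nonneg_of_lt_one_right (Real.cos_le_one _) hcos.le hcos1
    obtain ⟨h3, h4⟩ := coshInv_im_mem hw
    have hww := cosh_coshInv hw
    set a := coshInv (((Real.cos θ : ℝ) : ℂ) * Complex.cosh (v / 2)) with ha
    have hcc : (c : ℂ) * Complex.cosh a = Complex.cosh (v / 2) := by
      rw [hww, ← mul_assoc, ← Complex.ofReal_mul, hc_def, inv_mul_cancel₀ hcosθ.ne',
        Complex.ofReal_one, one_mul]
    refine ⟨2 * a, ⟨⟨?_, ?_⟩, ?_⟩, ?_⟩
    · simp; linarith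
    · simp; linarith
    · rintro ⟨hr, -, hi⟩
      have hr0 : a.re = 0 := by simpa using hr
      have hi0 : a.im ≤ θ := by simpa using hi
      have hge : Real.cos θ ≤ Real.cos a.im :=
        Real.cos_le_cos_of_nonneg_of_le_pi h3.le (by linarith) hi0
      have him := congrArg Complex.im hcc
      have hre := congrArg Complex.re hcc
      rw [Complex.im_ofReal_mul, cosh_im_eq, cosh_im_eq, hr0, Real.sinh_zero] at him
      rw [Complex.re_ofReal_mul, cosh_re_eq, cosh_re_eq, hr0, Real.cosh_zero] at hre
      have hsin : 0 < Real.sin (v / 2).im := Real.sin_pos_of_pos_of_lt_pi h0 (by linarith)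
      have hv0 : (v / 2).re = 0 := by
        have : Real.sinh (v / 2).re = 0 := by
          rcases mul_eq_zero.1 (him.symm.trans (by ring)) with h | h
          · exact h
          · exact absurd h hsin.ne'
        exact Real.sinh_eq_zero.1 this
      rw [hv0, Real.cosh_zero, one_mul, one_mul] at hre
      have : 1 ≤ c * Real.cos a.im := by
        rw [hc_def, one_le_inv_mul₀ hcosθ]
        exact hge
      linarith
    · change 2 * coshInv (c * Complex.cosh (2 * a / 2)) = v
      rw [mul_div_cancel_left₀ _ two_ne_zero, hcc, coshInv_cosh h0 h1,
        mul_div_cancel₀ _ two_ne_zero]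
  · intro z hz
    refine DifferentiableAt.differentiableWithinAt (DifferentiableAt.const_mul ?_ _)
    exact DifferentiableAt.comp (g := coshInv) (f := fun z => (c : ℂ) * Complex.cosh (z / 2)) z
      (differentiableAt_coshInv (hmem z hz)) (by fun_prop)
  · intro z hz
    rw [mul_div_cancel_left₀ _ two_ne_zero]
    exact hcosh z hz
  · have hre : Tendsto Complex.re (comap Complex.re atTop ⊓ Filter.principal D) atTop :=
      tendsto_comap.mono_left inf_le_left
    have hD : ∀ᶠ z in comap Complex.re atTop ⊓ Filter.principal D, z ∈ D :=
      mem_inf_of_right (mem_principal_self _)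
    have := (tendsto_sub_of_cosh_eq_mul_cosh
      (F := fun z => coshInv (c * Complex.cosh (z / 2))) (A := fun z => z / 2) hc
      (hD.mono hcosh)
      (by
        filter_upwards [hD, hre.eventually_gt_atTop 0] with z hz hz0
        exact (hsign z hz).1 (by rw [hre2]; linarith))
      (hD.mono himlt)
      (by simpa only [hre2] using hre.atTop_div_const two_pos)).const_mul 2
    convert this using 2
    · ring
    · push_cast; ring
  · have hre : Tendsto Complex.re (comap Complex.re atBot ⊓ Filter.principal D) atBot :=
      tendsto_comap.mono_left inf_le_left
    have hD : ∀ᶠ z in comap Complex.re atBot ⊓ Filter.principal D, z ∈ D :=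
      mem_inf_of_right (mem_principal_self _)
    have := (tendsto_sub_of_cosh_eq_mul_cosh
      (F := fun z => -coshInv (c * Complex.cosh (z / 2))) (A := fun z => -(z / 2)) hc
      (hD.mono fun z hz => by rw [Complex.cosh_neg, Complex.cosh_neg, hcosh z hz])
      (by
        filter_upwards [hD, hre.eventually_lt_atBot 0] with z hz hz0
        exact neg_pos.2 ((hsign z hz).2 (by rw [hre2]; linarith)))
      (hD.mono fun z hz => by
        rw [← neg_sub', Complex.neg_im, abs_neg]
        exact himlt z hz)
      (by
        simpa only [hre2, Complex.neg_re, Function.comp_def] using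
          tendsto_neg_atBot_atTop.comp (hre.atBot_div_const two_pos))).const_mul (-2)
    convert this using 2
    · ring
    · push_cast; ring
end
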